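/- Suppose sequences (x_k), (γ_k), (α_k), (p_k), (Φ_k) are generated by the nonmonotone proximal gradient method with backtracking information, and assume additionally that ∇f is locally Lipschitz continuous (every point of X has a neighborhood on which ∇f is Lipschitz). Let x* be an accumulation point of (x_k). Then g(x*) < ∞, x* is M-stationary for φ (that is, 0 ∈ ∂φ(x*), equivalently −∇f(x*) ∈ ∂g(x*)), and φ(x*) = φ_*, where φ_* is the common limit of the sequences (Φ_k) and (φ(x_k)). -/

import Mathlib

open Filter Topology
open scoped RealInnerProductSpace

variable {X : Type*} [NormedAddCommGroup X] [InnerProductSpace ℝ X] [FiniteDimensional ℝ X]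

/-- The extended-real-valued composite objective `φ = f + g`. -/
noncomputable def phiE (f : X → ℝ) (g : X → EReal) (z : X) : EReal :=
  (f z : EReal) + g z

/-- `y` minimizes `z ↦ g z + ⟪v, z - x⟫ + ‖z - x‖² / (2γ)` over `X`
(a proximal gradient step from `x` with gradient vector `v` and stepsize `γ`). -/
def ProxMin (g : X → EReal) (v x : X) (γ : ℝ) (y : X) : Prop :=
  ∀ z : X,
    g y + ((⟪v, y - x⟫ + ‖y - x‖ ^ 2 / (2 * γ) : ℝ) : EReal) ≤
      g z + ((⟪v, z - x⟫ + ‖z - x‖ ^ 2 / (2 * γ) : ℝ) : EReal)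

/-- Fréchet (regular) subgradient of `h` at `xb`. -/
noncomputable def FSubgrad (h : X → EReal) (xb v : X) : Prop :=
  h xb ≠ ⊤ ∧
    0 ≤ Filter.liminf
        (fun z : X => (h z - h xb - ((⟪v, z - xb⟫ : ℝ) : EReal)) / ((‖z - xb‖ : ℝ) : EReal))
        (𝓝[≠] xb)

/-- Limiting (Mordukhovich) subgradient of `h` at `xb`. -/
noncomputable def MSubgrad (h : X → EReal) (xb v : X) : Prop :=
  h xb ≠ ⊤ ∧
    ∃ xs vs : ℕ → X,
      Tendsto xs atTop (𝓝 xb) ∧ Tendsto vs atTop (𝓝 v) ∧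
        Tendsto (fun j => h (xs j)) atTop (𝓝 (h xb)) ∧ ∀ j, FSubgrad h (xs j) (vs j)

/-- The sequences `x, γ, α, p, Φ` are generated by the nonmonotone proximal gradient
method for `φ = f + g` with parameters `γmax, αmin, αmax, pmin`. -/
structure NMPG (f : X → ℝ) (g : X → EReal) (γmax αmin αmax pmin : ℝ)
    (x : ℕ → X) (γ α p : ℕ → ℝ) (Φ : ℕ → ℝ) : Prop where
  hf : ContDiff ℝ 1 f
  hg_nebot : ∀ z, g z ≠ ⊥
  hg_proper : ∃ z, g z ≠ ⊤
  hg_lsc : LowerSemicontinuous g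
  hg_proxbdd : ∃ γ₀ : ℝ, 0 < γ₀ ∧ ∃ m : ℝ, ∀ z,
    (m : EReal) ≤ g z + ((‖z‖ ^ 2 / (2 * γ₀) : ℝ) : EReal)
  hφ_bdd : ∃ m : ℝ, ∀ z, (m : EReal) ≤ phiE f g z
  hγmax : 0 < γmax
  hαmin : 0 < αmin
  hαα : αmin ≤ αmax
  hαmax : αmax < 1
  hpmin : 0 < pmin
  hpone : pmin ≤ 1
  hx0 : g (x 0) ≠ ⊤
  hΦ0 : (Φ 0 : EReal) = phiE f g (x 0)
  hγpos : ∀ k, 0 < γ k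
  hγle : ∀ k, γ k ≤ γmax
  hαmem : ∀ k, α k ∈ Set.Icc αmin αmax
  hpmem : ∀ k, p k ∈ Set.Icc pmin 1
  hstep : ∀ k : ℕ, ProxMin g (gradient f (x k)) (x k) (γ (k + 1)) (x (k + 1))
  hls : ∀ k : ℕ, phiE f g (x (k + 1)) ≤
      ((Φ k - (1 - α (k + 1)) / (2 * γ (k + 1)) * ‖x (k + 1) - x k‖ ^ 2 : ℝ) : EReal)
  hΦrec : ∀ k : ℕ, Φ (k + 1) = (1 - p (k + 1)) * Φ k + p (k + 1) * (phiE f g (x (k + 1))).toReal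

/-- Backtracking information: for every `k`, either `γ k ≥ γmin`, or the previously
attempted stepsize `σ ∈ [γ k / βmax, γ k / βmin]` was rejected by the line search. -/
def Backtrack (f : X → ℝ) (g : X → EReal) (αmin γmin βmin βmax : ℝ)
    (x : ℕ → X) (γ : ℕ → ℝ) (Φ : ℕ → ℝ) : Prop :=
  ∀ k : ℕ, γmin ≤ γ (k + 1) ∨
    ∃ σ : ℝ, ∃ y : X, γ (k + 1) / βmax ≤ σ ∧ σ ≤ γ (k + 1) / βmin ∧
      ProxMin g (gradient f (x k)) (x k) σ y ∧
      ((Φ k - (1 - αmin) / (2 * σ) * ‖y - x k‖ ^ 2 : ℝ) : EReal) < phiE f g y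

omit [FiniteDimensional ℝ X] in
lemma ProxMin.real_le {g : X → EReal} (hbot : ∀ z, g z ≠ ⊥) {v x y z : X} {γ : ℝ}
    (hp : ProxMin g v x γ y) (hy : g y ≠ ⊤) (hz : g z ≠ ⊤) :
    (g y).toReal + (⟪v, y - x⟫ + ‖y - x‖ ^ 2 / (2 * γ)) ≤
      (g z).toReal + (⟪v, z - x⟫ + ‖z - x‖ ^ 2 / (2 * γ)) := by
  have h := hp z
  rw [← EReal.coe_toReal hy (hbot y), ← EReal.coe_toReal hz (hbot z)] at h
  exact_mod_cast h

omit [FiniteDimensional ℝ X] in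
lemma ProxMin.ne_top {g : X → EReal} {v x y z : X} {γ : ℝ}
    (hp : ProxMin g v x γ y) (hz : g z ≠ ⊤) : g y ≠ ⊤ := by
  intro hy
  have h := hp z
  rw [hy, EReal.top_add_coe, top_le_iff] at h
  exact (EReal.add_lt_top hz (EReal.coe_ne_top _)).ne h

omit [NormedAddCommGroup X] [InnerProductSpace ℝ X] [FiniteDimensional ℝ X] in
lemma phiE_eq_coe {g : X → EReal} (f : X → ℝ) (hbot : ∀ z, g z ≠ ⊥) {z : X} (hz : g z ≠ ⊤) :
    phiE f g z = ((f z + (g z).toReal : ℝ) : EReal) := by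
  rw [phiE, EReal.coe_add, EReal.coe_toReal hz (hbot z)]

omit [NormedAddCommGroup X] [InnerProductSpace ℝ X] [FiniteDimensional ℝ X] in
lemma phiE_eq_top {g : X → EReal} (f : X → ℝ) {z : X} (hz : g z = ⊤) : phiE f g z = ⊤ := by
  rw [phiE, hz, EReal.coe_add_top]

omit [FiniteDimensional ℝ X] in
/-- A first-order lower estimate up to arbitrarily small linear errors gives a regular
subgradient. -/
lemma fsubgrad_phiE {f : X → ℝ} {g : X → EReal} (hbot : ∀ z, g z ≠ ⊥) {y v : X} (hy : g y ≠ ⊤)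
    (H : ∀ ε > 0, ∀ᶠ z in 𝓝 y, g z ≠ ⊤ →
      f y + (g y).toReal + ⟪v, z - y⟫ - ε * ‖z - y‖ ≤ f z + (g z).toReal) :
    FSubgrad (phiE f g) y v := by
  refine ⟨by rw [phiE_eq_coe f hbot hy]; exact EReal.coe_ne_top _, ?_⟩
  refine le_of_forall_lt_imp_le_of_dense fun c hc => ?_
  obtain ⟨r, hcr, hr⟩ := EReal.lt_iff_exists_real_btwn.1 hc
  have hr0 : r < 0 := by exact_mod_cast hr
  refine hcr.le.trans (le_liminf_of_le (by isBoundedDefault) ?_)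
  filter_upwards [nhdsWithin_le_nhds (H (-r) (by linarith)), self_mem_nhdsWithin] with z hz hne
  have hpos : 0 < ‖z - y‖ := norm_pos_iff.2 (sub_ne_zero.2 hne)
  rw [phiE_eq_coe f hbot hy]
  by_cases hzt : g z = ⊤
  · rw [phiE_eq_top f hzt, EReal.top_sub_coe, EReal.top_sub_coe,
      EReal.top_div_of_pos_ne_top (by exact_mod_cast hpos) (EReal.coe_ne_top _)]
    exact le_top
  · rw [phiE_eq_coe f hbot hzt, ← EReal.coe_sub, ← EReal.coe_sub, ← EReal.coe_div]
    have := hz hzt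
    refine EReal.coe_le_coe_iff.2 ((le_div_iff₀ hpos).2 ?_)
    linarith

lemma ProxMin.fsubgrad {f : X → ℝ} {g : X → EReal} (hf : Differentiable ℝ f)
    (hbot : ∀ z, g z ≠ ⊥) {d x y : X} {γ : ℝ} (hγ : 0 < γ) (hp : ProxMin g d x γ y)
    (hy : g y ≠ ⊤) :
    FSubgrad (phiE f g) y (gradient f y - d - γ⁻¹ • (y - x)) := by
  refine fsubgrad_phiE hbot hy fun ε hε => ?_
  have h1 := (hasGradientAt_iff_isLittleO.1 (hf y).hasGradientAt).def (half_pos hε)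
  filter_upwards [h1, Metric.ball_mem_nhds y (mul_pos hγ hε)] with z hz hb hzt
  have hprox := hp.real_le hbot hy hzt
  have hb' : ‖z - y‖ < γ * ε := by rwa [mem_ball_iff_norm] at hb
  have hlow := (abs_le.1 (Real.norm_eq_abs _ ▸ hz)).1
  have hsq : ‖z - x‖ ^ 2 = ‖y - x‖ ^ 2 + 2 * ⟪y - x, z - y⟫ + ‖z - y‖ ^ 2 := by
    rw [← norm_add_sq_real]; congr 2; abel
  have hin : ⟪d, z - x⟫ = ⟪d, y - x⟫ + ⟪d, z - y⟫ := by
    rw [← inner_add_right]; congr 1; abel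
  have hquad : ‖z - y‖ ^ 2 / (2 * γ) ≤ ε / 2 * ‖z - y‖ := by
    rw [div_le_iff₀ (by positivity)]
    nlinarith [norm_nonneg (z - y)]
  have hexp : ‖z - x‖ ^ 2 / (2 * γ) =
      ‖y - x‖ ^ 2 / (2 * γ) + γ⁻¹ * ⟪y - x, z - y⟫ + ‖z - y‖ ^ 2 / (2 * γ) := by
    rw [hsq]; field_simp
  rw [inner_sub_left, inner_sub_left, real_inner_smul_left]
  rw [hexp, hin] at hprox
  linarith

/-- Descent inequality on a convex set where the gradient is Lipschitz. -/
lemma descent_of_lipschitzOn_gradient {f : X → ℝ} (hf : Differentiable ℝ f) {s : Set X}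
    (hs : Convex ℝ s) {K : NNReal} (hK : LipschitzOnWith K (gradient f) s) {x y : X}
    (hx : x ∈ s) (hy : y ∈ s) :
    f y ≤ f x + ⟪gradient f x, y - x⟫ + K * ‖y - x‖ ^ 2 := by
  have key := (convex_segment (𝕜 := ℝ) x y).norm_image_sub_le_of_norm_hasFDerivWithin_le'
    (f := f) (f' := fun z => InnerProductSpace.toDual ℝ X (gradient f z))
    (φ := InnerProductSpace.toDual ℝ X (gradient f x)) (C := K * ‖y - x‖)
    (fun z _ => ((hf z).hasGradientAt.hasFDerivAt).hasFDerivWithinAt)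
    (fun z hz => by
      rw [← map_sub, LinearIsometryEquiv.norm_map]
      refine (hK.norm_sub_le (hs.segment_subset hx hy hz) hx).trans ?_
      gcongr
      exact norm_sub_le_of_mem_segment hz)
    (left_mem_segment ℝ x y) (right_mem_segment ℝ x y)
  have := (abs_le.1 (Real.norm_eq_abs _ ▸ key)).2
  rw [InnerProductSpace.toDual_apply_apply] at this
  linarith

omit [FiniteDimensional ℝ X] in
/-- Proximal gradient steps with small stepsizes are short, uniformly over bounded data. -/
lemma exists_stepsize_prox_close {g : X → EReal} (hbot : ∀ z, g z ≠ ⊥) {γ₀ m : ℝ} (hγ₀ : 0 < γ₀)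
    (hm : ∀ z, (m : EReal) ≤ g z + ((‖z‖ ^ 2 / (2 * γ₀) : ℝ) : EReal))
    (R D M : ℝ) {r : ℝ} (hr : 0 < r) :
    ∃ σ₀ > 0, ∀ x v y : X, ∀ σ : ℝ, 0 < σ → σ < σ₀ → ‖x‖ ≤ R → ‖v‖ ≤ D → g x ≠ ⊤ →
      (g x).toReal ≤ M → ProxMin g v x σ y → ‖y - x‖ < r := by
  set M' := max 0 (M - m + R ^ 2 / γ₀)
  set D' := max 0 D
  have hM' : 0 ≤ M' := le_max_left _ _
  have hD' : 0 ≤ D' := le_max_left _ _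
  set C := 1 / γ₀ + M' / r ^ 2 + D' / r
  have hC : 0 < C := by positivity
  refine ⟨1 / (2 * C), by positivity, fun x v y σ hσ hσ₀ hx hv hgx hgM hp => ?_⟩
  by_contra! hry
  have hgy := hp.ne_top hgx
  have hprox := hp.real_le hbot hgy hgx
  have hmy := hm y
  rw [← EReal.coe_toReal hgy (hbot y)] at hmy
  have hmy' : m ≤ (g y).toReal + ‖y‖ ^ 2 / (2 * γ₀) := by exact_mod_cast hmy
  simp only [sub_self, inner_zero_right, norm_zero, ne_eq, OfNat.ofNat_ne_zero,
    not_false_eq_true, zero_pow, zero_div, add_zero] at hprox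
  have hinner := (abs_le.1 (abs_real_inner_le_norm v (y - x))).1
  set t := ‖y - x‖
  have ht : 0 < t := hr.trans_le hry
  have hDt : ‖v‖ * t ≤ D' * t := by gcongr; exact hv.trans (le_max_right _ _)
  have hyn : ‖y‖ ^ 2 ≤ 2 * t ^ 2 + 2 * R ^ 2 := by
    have h1 : ‖y‖ ≤ t + R := by
      have := norm_add_le (y - x) x
      rw [sub_add_cancel] at this
      linarith
    nlinarith [norm_nonneg y, sq_nonneg (t - R)]
  have hyd : ‖y‖ ^ 2 / (2 * γ₀) ≤ t ^ 2 / γ₀ + R ^ 2 / γ₀ := by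
    rw [← add_div, div_le_div_iff₀ (by positivity) hγ₀]
    nlinarith
  have hMM : M - m + R ^ 2 / γ₀ ≤ M' := le_max_right _ _
  have hMt : M' ≤ M' / r ^ 2 * t ^ 2 := by
    rw [div_mul_eq_mul_div, le_div_iff₀ (by positivity)]
    gcongr
  have hDt' : D' * t ≤ D' / r * t ^ 2 := by
    rw [div_mul_eq_mul_div, le_div_iff₀ hr]
    nlinarith [mul_le_mul_of_nonneg_left hry (mul_nonneg hD' ht.le)]
  have hle : t ^ 2 / (2 * σ) ≤ C * t ^ 2 := by
    have : C * t ^ 2 = t ^ 2 / γ₀ + M' / r ^ 2 * t ^ 2 + D' / r * t ^ 2 := by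
      simp only [C]; ring
    linarith
  rw [div_le_iff₀ (by positivity)] at hle
  rw [lt_div_iff₀ (by positivity)] at hσ₀
  nlinarith [pow_pos ht 2]

section Iterates

variable {f : X → ℝ} {g : X → EReal} {γmax αmin αmax pmin : ℝ} {x : ℕ → X} {γ α p Φ : ℕ → ℝ}

namespace NMPG

lemma g_ne_top (h : NMPG f g γmax αmin αmax pmin x γ α p Φ) (k : ℕ) : g (x k) ≠ ⊤ := by
  obtain ⟨z, hz⟩ := h.hg_proper
  cases k with
  | zero => exact h.hx0
  | succ k => exact (h.hstep k).ne_top hz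

lemma phiE_eq (h : NMPG f g γmax αmin αmax pmin x γ α p Φ) (k : ℕ) :
    phiE f g (x k) = ((f (x k) + (g (x k)).toReal : ℝ) : EReal) :=
  phiE_eq_coe f h.hg_nebot (h.g_ne_top k)

lemma line_search (h : NMPG f g γmax αmin αmax pmin x γ α p Φ) (k : ℕ) :
    f (x (k + 1)) + (g (x (k + 1))).toReal ≤
      Φ k - (1 - α (k + 1)) / (2 * γ (k + 1)) * ‖x (k + 1) - x k‖ ^ 2 := by
  have := h.hls k
  rw [h.phiE_eq] at this
  exact EReal.coe_le_coe_iff.1 this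

lemma merit_succ (h : NMPG f g γmax αmin αmax pmin x γ α p Φ) (k : ℕ) :
    Φ (k + 1) = (1 - p (k + 1)) * Φ k +
      p (k + 1) * (f (x (k + 1)) + (g (x (k + 1))).toReal) := by
  rw [h.hΦrec, h.phiE_eq, EReal.toReal_coe]

lemma p_pos (h : NMPG f g γmax αmin αmax pmin x γ α p Φ) (k : ℕ) : 0 < p k :=
  h.hpmin.trans_le (h.hpmem k).1

lemma cost_succ_le (h : NMPG f g γmax αmin αmax pmin x γ α p Φ) (k : ℕ) :
    f (x (k + 1)) + (g (x (k + 1))).toReal ≤ Φ k := by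
  have h1 := h.line_search k
  have h2 : 0 ≤ (1 - α (k + 1)) / (2 * γ (k + 1)) * ‖x (k + 1) - x k‖ ^ 2 := by
    have := h.hγpos (k + 1)
    have := (h.hαmem (k + 1)).2
    have := h.hαmax
    have : 0 ≤ 1 - α (k + 1) := by linarith
    positivity
  linarith

lemma cost_le_merit (h : NMPG f g γmax αmin αmax pmin x γ α p Φ) (k : ℕ) :
    f (x k) + (g (x k)).toReal ≤ Φ k := by
  cases k with
  | zero =>
    have := h.hΦ0
    rw [h.phiE_eq] at this
    exact (EReal.coe_eq_coe_iff.1 this).ge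
  | succ k =>
    rw [h.merit_succ k]
    nlinarith [h.cost_succ_le k, (h.hpmem (k + 1)).2]

lemma merit_antitone (h : NMPG f g γmax αmin αmax pmin x γ α p Φ) : Antitone Φ := by
  refine antitone_nat_of_succ_le fun k => ?_
  rw [h.merit_succ k]
  nlinarith [h.cost_succ_le k, h.p_pos (k + 1)]

lemma exists_tendsto_merit (h : NMPG f g γmax αmin αmax pmin x γ α p Φ) :
    ∃ l, Tendsto Φ atTop (𝓝 l) := by
  obtain ⟨m, hm⟩ := h.hφ_bdd
  refine ⟨_, tendsto_atTop_ciInf h.merit_antitone ⟨m, ?_⟩⟩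
  rintro _ ⟨k, rfl⟩
  have := hm (x k)
  rw [h.phiE_eq] at this
  exact (EReal.coe_le_coe_iff.1 this).trans (h.cost_le_merit k)

lemma tendsto_merit_gap (h : NMPG f g γmax αmin αmax pmin x γ α p Φ) {l : ℝ}
    (hl : Tendsto Φ atTop (𝓝 l)) :
    Tendsto (fun k => Φ k - (f (x (k + 1)) + (g (x (k + 1))).toReal)) atTop (𝓝 0) := by
  have hd : Tendsto (fun k => (Φ k - Φ (k + 1)) / pmin) atTop (𝓝 0) := by
    simpa using (hl.sub (hl.comp (tendsto_add_atTop_nat 1))).div_const pmin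
  refine squeeze_zero (fun k => sub_nonneg.2 (h.cost_succ_le k)) (fun k => ?_) hd
  rw [le_div_iff₀ h.hpmin, h.merit_succ k]
  nlinarith [h.cost_succ_le k, (h.hpmem (k + 1)).1]

lemma tendsto_cost (h : NMPG f g γmax αmin αmax pmin x γ α p Φ) {l : ℝ}
    (hl : Tendsto Φ atTop (𝓝 l)) :
    Tendsto (fun k => f (x k) + (g (x k)).toReal) atTop (𝓝 l) := by
  rw [← tendsto_add_atTop_iff_nat 1]
  simpa using hl.sub (h.tendsto_merit_gap hl)

lemma tendsto_step (h : NMPG f g γmax αmin αmax pmin x γ α p Φ) {l : ℝ}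
    (hl : Tendsto Φ atTop (𝓝 l)) :
    Tendsto (fun k => x (k + 1) - x k) atTop (𝓝 0) := by
  have hα : 0 < 1 - αmax := sub_pos.2 h.hαmax
  have hb : Tendsto (fun k => 2 * γmax / (1 - αmax) *
      (Φ k - (f (x (k + 1)) + (g (x (k + 1))).toReal))) atTop (𝓝 0) := by
    simpa using (h.tendsto_merit_gap hl).const_mul (2 * γmax / (1 - αmax))
  have hsq : Tendsto (fun k => ‖x (k + 1) - x k‖ ^ 2) atTop (𝓝 0) := by
    refine squeeze_zero (fun k => sq_nonneg _) (fun k => ?_) hb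
    have h1 := h.line_search k
    have hγ := h.hγpos (k + 1)
    have h2 : (1 - αmax) / (2 * γmax) * ‖x (k + 1) - x k‖ ^ 2 ≤
        (1 - α (k + 1)) / (2 * γ (k + 1)) * ‖x (k + 1) - x k‖ ^ 2 := by
      gcongr
      · linarith [(h.hαmem (k + 1)).2]
      · exact (h.hαmem (k + 1)).2
      · exact h.hγle (k + 1)
    have hγm := h.hγmax
    calc ‖x (k + 1) - x k‖ ^ 2 = 2 * γmax / (1 - αmax) *
          ((1 - αmax) / (2 * γmax) * ‖x (k + 1) - x k‖ ^ 2) := by field_simp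
      _ ≤ _ := by gcongr; linarith
  refine tendsto_zero_iff_norm_tendsto_zero.2 ?_
  simpa [Real.sqrt_sq, norm_nonneg] using hsq.sqrt

/-- The stepsizes stay bounded away from zero near any point. -/
lemma exists_stepsize_lower_bound (h : NMPG f g γmax αmin αmax pmin x γ α p Φ)
    {γmin βmin βmax : ℝ} (hγmin : 0 < γmin) (hβmin : 0 < βmin) (hββ : βmin ≤ βmax)
    (hbt : Backtrack f g αmin γmin βmin βmax x γ Φ)
    (hLip : LocallyLipschitz (gradient f)) (a : X) :
    ∃ c > 0, ∀ᶠ z in 𝓝 a, ∀ k, x k = z → c ≤ γ (k + 1) := by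
  obtain ⟨K, s, hs, hK⟩ := hLip a
  obtain ⟨ρ, hρ, hρs⟩ := Metric.mem_nhds_iff.1 hs
  obtain ⟨γ₀, hγ₀, m, hm⟩ := h.hg_proxbdd
  have hfd : Differentiable ℝ f := h.hf.differentiable one_ne_zero
  obtain ⟨σ₀, hσ₀, hclose⟩ := exists_stepsize_prox_close h.hg_nebot hγ₀ hm (‖a‖ + ρ)
    (‖gradient f a‖ + 1) (Φ 0 - f a + 1) (half_pos hρ)
  have hK1 : (0 : ℝ) < K + 1 := by positivity
  have hα := h.hαmin
  set σ₁ := min σ₀ (αmin / (2 * (K + 1)))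
  have hσ₁ : 0 < σ₁ := lt_min hσ₀ (by positivity)
  refine ⟨min γmin (σ₁ * βmin), lt_min hγmin (by positivity), ?_⟩
  filter_upwards [Metric.ball_mem_nhds a (half_pos hρ),
    hLip.continuous.norm.continuousAt.eventually_lt_const (lt_add_one ‖gradient f a‖),
    hfd.continuous.continuousAt.eventually_const_lt (sub_one_lt (f a))] with z hz hDz hfz k hk
  subst hk
  by_contra! hlt
  obtain ⟨hlt₁, hlt₂⟩ := lt_min_iff.1 hlt
  rcases hbt k with hge | ⟨σ, y, hσl, hσu, hprox, hrej⟩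
  · exact hlt₁.not_ge hge
  have hγ := h.hγpos (k + 1)
  have hσ : 0 < σ := lt_of_lt_of_le (div_pos hγ (hβmin.trans_le hββ)) hσl
  have hσlt : σ < σ₁ := hσu.trans_lt ((div_lt_iff₀ hβmin).2 hlt₂)
  have hgx := h.g_ne_top k
  have hcost := h.cost_le_merit k
  have hmono := h.merit_antitone (Nat.zero_le k)
  rw [mem_ball_iff_norm] at hz
  have hxn : ‖x k‖ ≤ ‖a‖ + ρ := by
    have := norm_add_le (x k - a) a
    rw [sub_add_cancel] at this
    linarith
  have hyx : ‖y - x k‖ < ρ / 2 := hclose (x k) _ y σ hσ (hσlt.trans_le (min_le_left _ _)) hxn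
    hDz.le hgx (by linarith) hprox
  have hya : ‖y - a‖ < ρ := by
    have := norm_add_le (y - x k) (x k - a)
    rw [sub_add_sub_cancel] at this
    linarith
  have hdesc := descent_of_lipschitzOn_gradient hfd (convex_ball a ρ) (hK.mono hρs)
    (mem_ball_iff_norm.2 (by linarith : ‖x k - a‖ < ρ)) (mem_ball_iff_norm.2 hya)
  have hgy := hprox.ne_top hgx
  have hpr := hprox.real_le h.hg_nebot hgy hgx
  rw [phiE_eq_coe f h.hg_nebot hgy, EReal.coe_lt_coe_iff] at hrej
  have hKσ : (K : ℝ) ≤ αmin / (2 * σ) := by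
    have h1 := hσlt.trans_le (min_le_right _ _)
    rw [lt_div_iff₀ (by positivity)] at h1
    rw [le_div_iff₀ (by positivity)]
    nlinarith
  have hKt := mul_le_mul_of_nonneg_right hKσ (sq_nonneg ‖y - x k‖)
  have hsplit : (1 - αmin) / (2 * σ) * ‖y - x k‖ ^ 2 =
      ‖y - x k‖ ^ 2 / (2 * σ) - αmin / (2 * σ) * ‖y - x k‖ ^ 2 := by ring
  simp only [sub_self, inner_zero_right, norm_zero, ne_eq, OfNat.ofNat_ne_zero,
    not_false_eq_true, zero_pow, zero_div, add_zero] at hpr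
  linarith

/-- Finiteness of `g` at a limit of iterates, and the cost there is at most the limit cost. -/
lemma cost_limit_le (h : NMPG f g γmax αmin αmax pmin x γ α p Φ) {l : ℝ}
    (hl : Tendsto Φ atTop (𝓝 l)) {n : ℕ → ℕ} (hn : Tendsto n atTop atTop) {a : X}
    (ha : Tendsto (fun j => x (n j)) atTop (𝓝 a)) :
    g a ≤ ((l - f a : ℝ) : EReal) := by
  have hlim : Tendsto (fun j => (g (x (n j))).toReal) atTop (𝓝 (l - f a)) := by
    have := ((h.tendsto_cost hl).comp hn).sub ((h.hf.continuous.tendsto a).comp ha)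
    simpa [Function.comp_def] using this
  refine le_of_forall_lt_imp_le_of_dense fun c hc => ?_
  have hlim' := (continuous_coe_real_ereal.tendsto _).comp hlim
  refine ge_of_tendsto hlim' ?_
  filter_upwards [ha.eventually (h.hg_lsc a c hc)] with j hj
  simpa [EReal.coe_toReal (h.g_ne_top _) (h.hg_nebot _)] using hj.le

lemma le_cost_limit (h : NMPG f g γmax αmin αmax pmin x γ α p Φ) {l : ℝ}
    (hl : Tendsto Φ atTop (𝓝 l)) {n : ℕ → ℕ} (hn : Tendsto n atTop atTop) {a : X}
    (ha : Tendsto (fun j => x (n j)) atTop (𝓝 a))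
    (ha' : Tendsto (fun j => x (n j + 1)) atTop (𝓝 a)) (hga : g a ≠ ⊤)
    (hcont : Continuous (gradient f)) {c : ℝ} (hc : 0 < c)
    (hγc : ∀ᶠ j in atTop, c ≤ γ (n j + 1)) :
    l ≤ f a + (g a).toReal := by
  have hlhs := (h.tendsto_cost hl).comp ((tendsto_add_atTop_nat 1).comp hn)
  have hgrad := (hcont.tendsto a).comp ha
  have hrhs : Tendsto (fun j => f (x (n j + 1)) + (g a).toReal +
      ⟪gradient f (x (n j)), a - x (n j + 1)⟫ + ‖a - x (n j)‖ ^ 2 / (2 * c)) atTop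
      (𝓝 (f a + (g a).toReal + ⟪gradient f a, a - a⟫ + ‖a - a‖ ^ 2 / (2 * c))) :=
    ((((h.hf.continuous.tendsto a).comp ha').add_const _).add
      (hgrad.inner (ha'.const_sub a))).add (((ha.const_sub a).norm.pow 2).div_const _)
  have hfin := le_of_tendsto_of_tendsto hlhs hrhs (by
    filter_upwards [hγc] with j hj
    have hp := (h.hstep (n j)).real_le h.hg_nebot (h.g_ne_top _) hga
    have h1 : ‖a - x (n j)‖ ^ 2 / (2 * γ (n j + 1)) ≤ ‖a - x (n j)‖ ^ 2 / (2 * c) := by gcongr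
    have h2 : 0 ≤ ‖x (n j + 1) - x (n j)‖ ^ 2 / (2 * γ (n j + 1)) := by
      have := h.hγpos (n j + 1)
      positivity
    have h3 : ⟪gradient f (x (n j)), a - x (n j)⟫ =
        ⟪gradient f (x (n j)), a - x (n j + 1)⟫ +
          ⟪gradient f (x (n j)), x (n j + 1) - x (n j)⟫ := by
      rw [← inner_add_right, sub_add_sub_cancel]
    simp only [Function.comp_apply]
    linarith)
  simpa using hfin

lemma tendsto_subgradient {n : ℕ → ℕ} {a : X}
    (ha : Tendsto (fun j => x (n j)) atTop (𝓝 a))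
    (ha' : Tendsto (fun j => x (n j + 1)) atTop (𝓝 a))
    (hcont : Continuous (gradient f)) {c : ℝ} (hc : 0 < c)
    (hγc : ∀ᶠ j in atTop, c ≤ γ (n j + 1)) :
    Tendsto (fun j => gradient f (x (n j + 1)) - gradient f (x (n j)) -
      (γ (n j + 1))⁻¹ • (x (n j + 1) - x (n j))) atTop (𝓝 0) := by
  have h1 := ((hcont.tendsto a).comp ha').sub ((hcont.tendsto a).comp ha)
  have h2 : Tendsto (fun j => (γ (n j + 1))⁻¹ • (x (n j + 1) - x (n j))) atTop (𝓝 0) := by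
    have hb : Tendsto (fun j => c⁻¹ * ‖x (n j + 1) - x (n j)‖) atTop (𝓝 0) := by
      simpa using (ha'.sub ha).norm.const_mul c⁻¹
    refine squeeze_zero_norm' ?_ hb
    filter_upwards [hγc] with j hj
    rw [norm_smul, norm_inv, Real.norm_of_nonneg (hc.le.trans hj)]
    gcongr
  simpa [Function.comp_def] using h1.sub h2

end NMPG

end Iterates

theorem stmt_8 (f : X → ℝ) (g : X → EReal) (γmax αmin αmax pmin : ℝ)
    (x : ℕ → X) (γ α p : ℕ → ℝ) (Φ : ℕ → ℝ)
    (h : NMPG f g γmax αmin αmax pmin x γ α p Φ)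
    (γmin βmin βmax : ℝ) (hγmin : 0 < γmin) (hβmin : 0 < βmin)
    (hββ : βmin ≤ βmax) (hβmax : βmax < 1)
    (hbt : Backtrack f g αmin γmin βmin βmax x γ Φ)
    (hLip : LocallyLipschitz (gradient f))
    (xstar : X) (ks : ℕ → ℕ) (hks : StrictMono ks)
    (hconv : Tendsto (fun j => x (ks j)) atTop (𝓝 xstar)) :
    g xstar ≠ ⊤ ∧ MSubgrad (phiE f g) xstar 0 ∧
      ∃ φstar : ℝ, Tendsto Φ atTop (𝓝 φstar) ∧
        Tendsto (fun k => phiE f g (x k)) atTop (𝓝 (φstar : EReal)) ∧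
        phiE f g xstar = (φstar : EReal) := by
  obtain ⟨l, hl⟩ := h.exists_tendsto_merit
  have hφ : Tendsto (fun k => phiE f g (x k)) atTop (𝓝 (l : EReal)) := by
    simpa only [Function.comp_def, ← h.phiE_eq] using
      (continuous_coe_real_ereal.tendsto l).comp (h.tendsto_cost hl)
  have hle := h.cost_limit_le hl hks.tendsto_atTop hconv
  have hga : g xstar ≠ ⊤ := (hle.trans_lt (EReal.coe_lt_top _)).ne
  obtain ⟨n, hn⟩ : ∃ n : ℕ → ℕ, ∀ j, n j + 1 = ks (j + 1) :=
    ⟨fun j => ks (j + 1) - 1, fun j =>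
      Nat.sub_add_cancel ((Nat.succ_le_succ (Nat.zero_le j)).trans (hks.le_apply))⟩
  have hnt : Tendsto n atTop atTop :=
    tendsto_atTop_mono (fun j => Nat.le_of_succ_le_succ (hks.le_apply.trans (hn j).ge)) tendsto_id
  have ha' : Tendsto (fun j => x (n j + 1)) atTop (𝓝 xstar) := by
    simpa only [hn, Function.comp_def] using hconv.comp (tendsto_add_atTop_nat 1)
  have ha : Tendsto (fun j => x (n j)) atTop (𝓝 xstar) := by
    simpa [Function.comp_def] using ha'.sub ((h.tendsto_step hl).comp hnt)
  obtain ⟨c, hc, hγc⟩ := h.exists_stepsize_lower_bound hγmin hβmin hββ hbt hLip xstar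
  have hγc' : ∀ᶠ j in atTop, c ≤ γ (n j + 1) :=
    (ha.eventually hγc).mono fun j hj => hj (n j) rfl
  have hval : phiE f g xstar = (l : EReal) := by
    rw [← EReal.coe_toReal hga (h.hg_nebot _), EReal.coe_le_coe_iff] at hle
    rw [phiE_eq_coe f h.hg_nebot hga, EReal.coe_eq_coe_iff]
    exact le_antisymm (by linarith)
      (h.le_cost_limit hl hnt ha ha' hga hLip.continuous hc hγc')
  refine ⟨hga, ⟨by rw [hval]; exact EReal.coe_ne_top _, _, _, ha',
    NMPG.tendsto_subgradient ha ha' hLip.continuous hc hγc', ?_, fun j => ?_⟩, l, hl, hφ, hval⟩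
  · rw [hval]
    exact hφ.comp ((tendsto_add_atTop_nat 1).comp hnt)
  · exact (h.hstep (n j)).fsubgrad (h.hf.differentiable one_ne_zero) h.hg_nebot
      (h.hγpos _) (h.g_ne_top _)
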